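/- For every prime power q ≡ 1 (mod 4), the signed Paley plus graph (SP_q^+,□^+) has property P̂_{1,q}, property P̂_{2,(q−1)/2} and property P̂_{3,(q−5)/4}. -/

import Mathlib

open SimpleGraph

/-- A signed graph: a simple graph together with a symmetric sign function on
ordered pairs of vertices (`true` = positive, `false` = negative); only the values
on adjacent pairs are relevant. -/
structure SignedGraph (V : Type) where
  G : SimpleGraph V
  sign : V → V → Bool
  sign_symm : ∀ u v : V, sign u v = sign v u

namespace SignedGraph

variable {V W : Type}

/-- The sign of a walk: `true` iff it traverses an even number of negative edges
(counted with multiplicity). -/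
def walkSign (S : SignedGraph V) {u v : V} (w : S.G.Walk u v) : Bool :=
  (w.darts.map fun d => S.sign d.toProd.1 d.toProd.2).foldr (· == ·) true

/-- `SwitchEquiv S T` : `T` is obtained from `S` by switching a set of vertices
(encoded by `s : V → Bool`). -/
def SwitchEquiv (S T : SignedGraph V) : Prop :=
  S.G = T.G ∧ ∃ s : V → Bool, ∀ u v : V, S.G.Adj u v →
    T.sign u v = ((s u == s v) == S.sign u v)

/-- A sign-preserving homomorphism. -/
def IsSpHom (S : SignedGraph V) (T : SignedGraph W) (f : V → W) : Prop :=
  ∀ u v : V, S.G.Adj u v →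
    T.G.Adj (f u) (f v) ∧ T.sign (f u) (f v) = S.sign u v

/-- A homomorphism of signed graphs: maps edges to edges and preserves the signs of
closed walks. -/
def IsHom (S : SignedGraph V) (T : SignedGraph W) (f : V → W) : Prop :=
  ∃ hadj : ∀ u v : V, S.G.Adj u v → T.G.Adj (f u) (f v),
    ∀ (u : V) (w : S.G.Walk u u),
      T.walkSign (w.map ⟨f, fun {a b} h => hadj a b h⟩) = S.walkSign w

/-- A sign-preserving isomorphism. -/
def IsSpIso (S : SignedGraph V) (T : SignedGraph W) (f : V → W) : Prop :=
  Function.Bijective f ∧ IsSpHom S T f ∧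
    ∃ g : W → V, Function.LeftInverse g f ∧ Function.RightInverse g f ∧ IsSpHom T S g

/-- An isomorphism of signed graphs. -/
def IsIso (S : SignedGraph V) (T : SignedGraph W) (f : V → W) : Prop :=
  Function.Bijective f ∧ IsHom S T f ∧
    ∃ g : W → V, Function.LeftInverse g f ∧ Function.RightInverse g f ∧ IsHom T S g

/-- The sign-preserving chromatic number. -/
noncomputable def chromSp (S : SignedGraph V) : ℕ :=
  sInf {n : ℕ | ∃ T : SignedGraph (Fin n), ∃ f : V → Fin n, IsSpHom S T f}

/-- The signed chromatic number. -/
noncomputable def chromS (S : SignedGraph V) : ℕ :=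
  sInf {n : ℕ | ∃ T : SignedGraph (Fin n), ∃ f : V → Fin n, IsHom S T f}

/-- The double switching graph of a signed graph. -/
def doubleSwitch (S : SignedGraph V) : SignedGraph (V × Bool) where
  G := { Adj := fun p q => S.G.Adj p.1 q.1
         symm := ⟨fun p q h => S.G.symm.symm p.1 q.1 h⟩
         loopless := ⟨fun p h => S.G.loopless.irrefl p.1 h⟩ }
  sign := fun p q => ((p.2 == q.2) == S.sign p.1 q.1)
  sign_symm := by
    rintro ⟨p1, p2⟩ ⟨q1, q2⟩
    have := S.sign_symm p1 q1
    cases p2 <;> cases q2 <;> simp [this]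

end SignedGraph

/-- `G` has a complete minor on `n` branch sets: there are `n` nonempty, pairwise
disjoint vertex sets, each inducing a connected subgraph, with an edge of `G`
between any two of them. -/
def SimpleGraph.HasCompleteMinor {V : Type} (G : SimpleGraph V) (n : ℕ) : Prop :=
  ∃ B : Fin n → Set V,
    (∀ i, (B i).Nonempty) ∧
    (∀ i, (G.induce (B i)).Connected) ∧
    (∀ i j, i ≠ j → Disjoint (B i) (B j)) ∧
    (∀ i j, i ≠ j → ∃ u ∈ B i, ∃ v ∈ B j, G.Adj u v)


namespace SignedGraph

open scoped Classical in
/-- The signed Paley graph on a finite field `F` with `#F ≡ 1 (mod 4)`: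
the complete graph on `F`, an edge `uv` being positive iff `u - v` is a nonzero
square in `F`. -/
noncomputable def paley (F : Type) [Field F] [Fintype F]
    (hF : Fintype.card F % 4 = 1) : SignedGraph F where
  G := ⊤
  sign := fun u v => decide (∃ x : F, x ≠ 0 ∧ x * x = u - v)
  sign_symm := by
    have hsq : IsSquare (-1 : F) := by
      rw [FiniteField.isSquare_neg_one_iff]
      omega
    obtain ⟨i, hi⟩ := hsq
    have hi0 : i ≠ 0 := by
      intro h
      rw [h, mul_zero] at hi
      exact one_ne_zero (neg_eq_zero.mp hi)
    have key : ∀ a b : F, (∃ x : F, x ≠ 0 ∧ x * x = a - b) →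
        (∃ x : F, x ≠ 0 ∧ x * x = b - a) := by
      rintro a b ⟨x, hx0, hx⟩
      refine ⟨x * i, mul_ne_zero hx0 hi0, ?_⟩
      have hxi : x * i * (x * i) = x * x * (i * i) := by ring
      rw [hxi, hx, ← hi]
      ring
    intro u v
    simp only [decide_eq_decide]
    exact ⟨key u v, key v u⟩

end SignedGraph


namespace SignedGraph

/-- The signed Paley plus graph: add a vertex `∞` (here `none`) joined to every
other vertex by a positive edge. -/
noncomputable def paleyPlus (F : Type) [Field F] [Fintype F]
    (hF : Fintype.card F % 4 = 1) : SignedGraph (Option F) where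
  G := ⊤
  sign := fun u v =>
    match u, v with
    | none, _ => true
    | _, none => true
    | some a, some b => (paley F hF).sign a b
  sign_symm := by
    rintro (_ | a) (_ | b)
    · rfl
    · rfl
    · rfl
    · exact (paley F hF).sign_symm a b

end SignedGraph


namespace SignedGraph

/-- The `α`-neighborhood `N^α(v)` of a vertex in a signed graph
(`α = true` for positive, `α = false` for negative). -/
def signedNbhd {V : Type} (S : SignedGraph V) (v : V) (α : Bool) : Set V :=
  {u | S.G.Adj v u ∧ S.sign v u = α}

/-- Property `P_{k,ℓ}`: for every `k`-tuple of distinct vertices and every sign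
vector, the common signed neighborhood has at least `ℓ` vertices. -/
def HasPropP {V : Type} (S : SignedGraph V) (k ℓ : ℕ) : Prop :=
  ∀ v : Fin k → V, Function.Injective v → ∀ α : Fin k → Bool,
    ℓ ≤ (⋂ i, signedNbhd S (v i) (α i)).ncard

/-- Property `P̂_{k,ℓ}`: the switched version of `P_{k,ℓ}`, using
`N̂^α(v⃗) = N^α(v⃗) ∪ N^{-α}(v⃗)`. -/
def HasPropPhat {V : Type} (S : SignedGraph V) (k ℓ : ℕ) : Prop :=
  ∀ v : Fin k → V, Function.Injective v → ∀ α : Fin k → Bool,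
    ℓ ≤ ((⋂ i, signedNbhd S (v i) (α i)) ∪
         (⋂ i, signedNbhd S (v i) (!(α i)))).ncard

end SignedGraph


namespace SignedGraph

open scoped Classical in
/-- The signed adjacency matrix of a signed complete graph. -/
noncomputable def sgnMat {V : Type} (S : SignedGraph V) (v u : V) : ℤ :=
  if v = u then 0 else if S.sign v u then 1 else -1

lemma paley_sign_eq (F : Type) [Field F] [Fintype F] [DecidableEq F]
    (hF : Fintype.card F % 4 = 1) (a b : F) :
    sgnMat (paleyPlus F hF) (some a) (some b) = quadraticChar F (a - b) := by
  unfold sgnMat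
  by_cases hab : a = b
  · simp [hab]
  have h0 : a - b ≠ 0 := sub_ne_zero.mpr hab
  have hs : (paleyPlus F hF).sign (some a) (some b) = true ↔ IsSquare (a - b) := by
    simp only [paleyPlus, paley, decide_eq_true_eq]
    constructor
    · rintro ⟨x, -, hx⟩
      exact ⟨x, hx.symm⟩
    · rintro ⟨x, hx⟩
      refine ⟨x, ?_, hx.symm⟩
      rintro rfl
      exact h0 (by simpa using hx)
  by_cases hsq : IsSquare (a - b)
  · rw [(quadraticChar_one_iff_isSquare h0).mpr hsq]
    simp [hab, hs.mpr hsq]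
  · rw [quadraticChar_neg_one_iff_not_isSquare.mpr hsq]
    simp [hab, mt hs.mp hsq]

lemma sgnMat_none_some (F : Type) [Field F] [Fintype F]
    (hF : Fintype.card F % 4 = 1) (b : F) :
    sgnMat (paleyPlus F hF) none (some b) = 1 := by
  simp [sgnMat, paleyPlus]

lemma sgnMat_some_none (F : Type) [Field F] [Fintype F]
    (hF : Fintype.card F % 4 = 1) (b : F) :
    sgnMat (paleyPlus F hF) (some b) none = 1 := by
  simp [sgnMat, paleyPlus]

lemma sgnMat_self {V : Type} (S : SignedGraph V) (v : V) : sgnMat S v v = 0 := by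
  simp [sgnMat]

lemma paley_orth (F : Type) [Field F] [Fintype F]
    (hF : Fintype.card F % 4 = 1) (v w : Option F) (hvw : v ≠ w) :
    ∑ u, sgnMat (paleyPlus F hF) v u * sgnMat (paleyPlus F hF) w u = 0 := by
  classical
  have hchar : ringChar F ≠ 2 := by
    intro h
    have := FiniteField.even_card_iff_char_two.mp h
    omega
  have hlin : ∀ b : F, ∑ x : F, quadraticChar F (b - x) = 0 := by
    intro b
    rw [← quadraticChar_sum_zero hchar]
    exact (Equiv.subLeft b).sum_comp (fun x => quadraticChar F x)
  have hneg : quadraticChar F (-1) = 1 := by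
    rw [quadraticChar_one_iff_isSquare (by simp), FiniteField.isSquare_neg_one_iff]
    omega
  rcases v with _ | a <;> rcases w with _ | b
  · exact absurd rfl hvw
  · simp [Fintype.sum_option, sgnMat_none_some, sgnMat_self, paley_sign_eq, hlin, -quadraticChar_apply]
  · simp [Fintype.sum_option, sgnMat_none_some, sgnMat_self, paley_sign_eq, hlin, -quadraticChar_apply]
  · have hab : a - b ≠ 0 := sub_ne_zero.mpr (fun h => hvw (by rw [h]))
    simp only [Fintype.sum_option, sgnMat_some_none, paley_sign_eq]
    have hJ := jacobiSum_nontrivial_inv (quadraticChar_ne_one hchar)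
    rw [(quadraticChar_isQuadratic F).inv, hneg, jacobiSum] at hJ
    have hs : ∑ x : F, quadraticChar F (a - x) * quadraticChar F (b - x)
        = ∑ t : F, quadraticChar F t * quadraticChar F (1 - t) := by
      rw [← ((Equiv.mulLeft₀ (a - b) hab).trans (Equiv.subLeft a)).sum_comp]
      refine Finset.sum_congr rfl fun t _ => ?_
      have h1 : a - (a - (a - b) * t) = (a - b) * t := by ring
      have h2 : b - (a - (a - b) * t) = (-1) * ((a - b) * (1 - t)) := by ring
      have h3 := quadraticChar_sq_one hab
      change quadraticChar F (a - (a - (a - b) * t)) * quadraticChar F (b - (a - (a - b) * t)) = _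
      simp only [h1, h2, map_mul, hneg]
      linear_combination (quadraticChar F t * quadraticChar F (1 - t)) * h3
    rw [hs, hJ]
    norm_num

/-- Sign as an integer. -/
def sg (b : Bool) : ℤ := if b then 1 else -1

lemma ncard_ge {V : Type} [Fintype V] (A : Set V) (f : V → ℤ) (c : ℤ)
    (h1 : ∀ u ∈ A, f u ≤ c) (h2 : ∀ u ∉ A, f u ≤ 0) : ∑ u, f u ≤ c * A.ncard := by
  classical
  calc ∑ u, f u ≤ ∑ u, (if u ∈ A then c else 0) := by
        refine Finset.sum_le_sum fun u _ => ?_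
        split_ifs with h
        · exact h1 u h
        · exact h2 u h
    _ = c * A.ncard := by
        rw [← Finset.sum_filter, Finset.sum_const, Set.ncard_eq_toFinset_card']
        have : A.toFinset = Finset.univ.filter (· ∈ A) := by ext; simp
        rw [this]
        simp [mul_comm]

end SignedGraph

open SignedGraph in
/-- The signed Paley plus graph has properties `P̂_{1,q}`, `P̂_{2,(q-1)/2}` and
`P̂_{3,(q-5)/4}`. -/
theorem paleyPlus_hasPropPhat (F : Type) [Field F] [Fintype F]
    (hF : Fintype.card F % 4 = 1) :
    HasPropPhat (paleyPlus F hF) 1 (Fintype.card F) ∧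
    HasPropPhat (paleyPlus F hF) 2 ((Fintype.card F - 1) / 2) ∧
    HasPropPhat (paleyPlus F hF) 3 ((Fintype.card F - 5) / 4) := by
  classical
  have horth := paley_orth F hF
  have hG : ∀ a b, (paleyPlus F hF).G.Adj a b ↔ a ≠ b := by
    intro a b; simp [paleyPlus]
  generalize paleyPlus F hF = S at *
  refine ⟨?_, ?_, ?_⟩
  · intro v hv α
    have key := ncard_ge ((⋂ i, signedNbhd S (v i) (α i)) ∪
         (⋂ i, signedNbhd S (v i) (!(α i))))
         (fun u => 1 - (if v 0 = u then 1 else 0)) 1 (by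
            intro u _; split_ifs <;> norm_num) (by
            intro u hu
            simp only [Set.mem_union, Set.mem_iInter, signedNbhd, Set.mem_ofPred_eq, hG,
              Fin.forall_fin_one] at hu
            by_cases h : v 0 = u
            · simp [h]
            · exfalso
              revert hu
              cases S.sign (v 0) u <;> cases α 0 <;> simp [h])
    simp only [Finset.sum_sub_distrib, Finset.sum_ite_eq, Finset.mem_univ, if_true,
      Finset.sum_const, Finset.card_univ, Fintype.card_option] at key
    simp at key
    exact_mod_cast key
  · intro v hv α
    have h01 : v 0 ≠ v 1 := fun h => by simpa using hv h
    have key := ncard_ge ((⋂ i, signedNbhd S (v i) (α i)) ∪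
         (⋂ i, signedNbhd S (v i) (!(α i))))
         (fun u => 1 + sg (α 0) * sg (α 1) * (sgnMat S (v 0) u * sgnMat S (v 1) u)
           - (if v 0 = u then 1 else 0) - (if v 1 = u then 1 else 0)) 2 (by
            intro u _; dsimp only [sgnMat, sg]
            split_ifs <;> norm_num) (by
            intro u hu
            simp only [Set.mem_union, Set.mem_iInter, signedNbhd, Set.mem_ofPred_eq, hG,
              Fin.forall_fin_two] at hu
            dsimp only [sgnMat, sg]
            by_cases h : v 0 = u
            · by_cases h' : v 1 = u <;> simp [h, h']
            by_cases h' : v 1 = u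
            · simp [h, h']
            revert hu
            cases S.sign (v 0) u <;> cases S.sign (v 1) u <;> cases α 0 <;> cases α 1 <;>
              simp [h, h'])
    simp only [Finset.sum_sub_distrib, Finset.sum_add_distrib, ← Finset.mul_sum, horth _ _ h01,
      Finset.sum_ite_eq, Finset.mem_univ, if_true,
      Finset.sum_const, Finset.card_univ, Fintype.card_option] at key
    simp at key
    omega
  · intro v hv α
    have h01 : v 0 ≠ v 1 := fun h => by simpa using hv h
    have h02 : v 0 ≠ v 2 := fun h => by simpa using hv h
    have h12 : v 1 ≠ v 2 := fun h => by simpa using hv h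
    have key := ncard_ge ((⋂ i, signedNbhd S (v i) (α i)) ∪
         (⋂ i, signedNbhd S (v i) (!(α i))))
         (fun u => 1 + sg (α 0) * sg (α 1) * (sgnMat S (v 0) u * sgnMat S (v 1) u)
           + sg (α 0) * sg (α 2) * (sgnMat S (v 0) u * sgnMat S (v 2) u)
           + sg (α 1) * sg (α 2) * (sgnMat S (v 1) u * sgnMat S (v 2) u)
           - (if v 0 = u then 2 else 0) - (if v 1 = u then 2 else 0)
           - (if v 2 = u then 2 else 0)) 4 (by
            intro u _; dsimp only [sgnMat, sg]
            generalize S.sign (v 0) u = x0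
            generalize S.sign (v 1) u = x1
            generalize S.sign (v 2) u = x2
            split_ifs <;> norm_num) (by
            intro u hu
            simp only [Set.mem_union, Set.mem_iInter, signedNbhd, Set.mem_ofPred_eq, hG,
              Fin.forall_fin_succ] at hu
            simp at hu
            dsimp only [sgnMat, sg]
            by_cases h : v 0 = u
            · have h1 : v 1 ≠ u := fun h' => h01 (h.trans h'.symm)
              have h2 : v 2 ≠ u := fun h' => h02 (h.trans h'.symm)
              simp only [h, h1, h2, if_true, if_false]
              split_ifs <;> norm_num
            by_cases h' : v 1 = u
            · have h2 : v 2 ≠ u := fun h'' => h12 (h'.trans h''.symm)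
              simp only [h, h', h2, if_true, if_false]
              split_ifs <;> norm_num
            by_cases h'' : v 2 = u
            · simp only [h, h', h'', if_true, if_false]
              split_ifs <;> norm_num
            simp only [h, h', h'', if_false]
            revert hu
            cases S.sign (v 0) u <;> cases S.sign (v 1) u <;> cases S.sign (v 2) u <;>
              cases α 0 <;> cases α 1 <;> cases α 2 <;> simp [h, h', h''])
    simp only [Finset.sum_sub_distrib, Finset.sum_add_distrib, ← Finset.mul_sum, horth _ _ h01,
      horth _ _ h02, horth _ _ h12,
      Finset.sum_ite_eq, Finset.mem_univ, if_true,
      Finset.sum_const, Finset.card_univ, Fintype.card_option] at key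
    simp at key
    omega
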